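/- arXiv:1611.06819 — 3 statements merged into one kernel-verified Lean document; each statement's English description precedes it below -/
import Mathlib

section
/- Let k be a commutative ring and let H be a coquasi-bialgebra over k with preantipode S. Then for every h ∈ H one has ∑ h₁S(h₂) = ε(S(h))·1_H = ∑ S(h₁)h₂ (in Sweedler notation). -/
open scoped TensorProduct
open TensorProduct

/-- A coquasi-bialgebra structure on a coassociative counital `k`-coalgebra `H`:
a multiplication `mul` (a coalgebra morphism, given in curried bilinear form), a unit `one`,
and a convolution-invertible trilinear reassociator `ω` (with convolution inverse `ωInv`),
subject to the cocycle condition, unitality, and quasi-associativity.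
Sweedler-type identities are stated for arbitrary finite representations of the
comultiplications involved. -/
structure CoquasiBialgebra (k H : Type*) [CommRing k] [AddCommGroup H] [Module k H]
    [Coalgebra k H] where
  mul : H →ₗ[k] H →ₗ[k] H
  one : H
  ω : H →ₗ[k] H →ₗ[k] H →ₗ[k] k
  ωInv : H →ₗ[k] H →ₗ[k] H →ₗ[k] k
  /-- `mul` is comultiplicative: `Δ(xy) = ∑ x₁y₁ ⊗ x₂y₂`. -/
  comul_mul : ∀ (x y : H) (n m : ℕ) (x1 x2 : Fin n → H) (y1 y2 : Fin m → H),
    Coalgebra.comul (R := k) x = ∑ i, x1 i ⊗ₜ[k] x2 i →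
    Coalgebra.comul (R := k) y = ∑ j, y1 j ⊗ₜ[k] y2 j →
    Coalgebra.comul (R := k) (mul x y) =
      ∑ i, ∑ j, mul (x1 i) (y1 j) ⊗ₜ[k] mul (x2 i) (y2 j)
  counit_mul : ∀ x y, Coalgebra.counit (R := k) (mul x y) =
      Coalgebra.counit (R := k) x * Coalgebra.counit (R := k) y
  comul_one : Coalgebra.comul (R := k) one = one ⊗ₜ[k] one
  counit_one : Coalgebra.counit (R := k) one = 1
  one_mul : ∀ h, mul one h = h
  mul_one : ∀ h, mul h one = h
  /-- `ω(x ⊗ 1 ⊗ y) = ε(x)ε(y)`. -/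
  ω_one : ∀ x y, ω x one y = Coalgebra.counit (R := k) x * Coalgebra.counit (R := k) y
  /-- `ωInv` is the two-sided convolution inverse of `ω`. -/
  ω_conv_inv : ∀ (x y z : H) (n m p : ℕ) (x1 x2 : Fin n → H) (y1 y2 : Fin m → H)
    (z1 z2 : Fin p → H),
    Coalgebra.comul (R := k) x = ∑ i, x1 i ⊗ₜ[k] x2 i →
    Coalgebra.comul (R := k) y = ∑ j, y1 j ⊗ₜ[k] y2 j →
    Coalgebra.comul (R := k) z = ∑ l, z1 l ⊗ₜ[k] z2 l →
    (∑ i, ∑ j, ∑ l, ω (x1 i) (y1 j) (z1 l) * ωInv (x2 i) (y2 j) (z2 l) =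
      Coalgebra.counit (R := k) x * Coalgebra.counit (R := k) y *
        Coalgebra.counit (R := k) z) ∧
    (∑ i, ∑ j, ∑ l, ωInv (x1 i) (y1 j) (z1 l) * ω (x2 i) (y2 j) (z2 l) =
      Coalgebra.counit (R := k) x * Coalgebra.counit (R := k) y *
        Coalgebra.counit (R := k) z)
  /-- The 3-cocycle condition:
  `∑ ω(x₁ ⊗ y₁ ⊗ z₁w₁) ω(x₂y₂ ⊗ z₂ ⊗ w₂)
    = ∑ ω(y₁ ⊗ z₁ ⊗ w₁) ω(x₁ ⊗ y₂z₂ ⊗ w₂) ω(x₂ ⊗ y₃ ⊗ z₃)`. -/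
  cocycle : ∀ (x y z w : H) (nx ny nz nw : ℕ)
    (x1 x2 : Fin nx → H) (y1 y2 : Fin ny → H) (z1 z2 : Fin nz → H) (w1 w2 : Fin nw → H)
    (my : Fin ny → ℕ) (y21 y22 : ∀ j, Fin (my j) → H)
    (mz : Fin nz → ℕ) (z21 z22 : ∀ l, Fin (mz l) → H),
    Coalgebra.comul (R := k) x = ∑ i, x1 i ⊗ₜ[k] x2 i →
    Coalgebra.comul (R := k) y = ∑ j, y1 j ⊗ₜ[k] y2 j →
    Coalgebra.comul (R := k) z = ∑ l, z1 l ⊗ₜ[k] z2 l →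
    Coalgebra.comul (R := k) w = ∑ r, w1 r ⊗ₜ[k] w2 r →
    (∀ j, Coalgebra.comul (R := k) (y2 j) = ∑ p, y21 j p ⊗ₜ[k] y22 j p) →
    (∀ l, Coalgebra.comul (R := k) (z2 l) = ∑ q, z21 l q ⊗ₜ[k] z22 l q) →
    ∑ i, ∑ j, ∑ l, ∑ r,
        ω (x1 i) (y1 j) (mul (z1 l) (w1 r)) * ω (mul (x2 i) (y2 j)) (z2 l) (w2 r) =
      ∑ i, ∑ j, ∑ p, ∑ l, ∑ q, ∑ r,
        ω (y1 j) (z1 l) (w1 r) * ω (x1 i) (mul (y21 j p) (z21 l q)) (w2 r) *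
          ω (x2 i) (y22 j p) (z22 l q)
  /-- Quasi-associativity: `∑ x₁(y₁z₁) ω(x₂ ⊗ y₂ ⊗ z₂) = ∑ ω(x₁ ⊗ y₁ ⊗ z₁) (x₂y₂)z₂`. -/
  quasi_assoc : ∀ (x y z : H) (n m p : ℕ) (x1 x2 : Fin n → H) (y1 y2 : Fin m → H)
    (z1 z2 : Fin p → H),
    Coalgebra.comul (R := k) x = ∑ i, x1 i ⊗ₜ[k] x2 i →
    Coalgebra.comul (R := k) y = ∑ j, y1 j ⊗ₜ[k] y2 j →
    Coalgebra.comul (R := k) z = ∑ l, z1 l ⊗ₜ[k] z2 l →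
    ∑ i, ∑ j, ∑ l, ω (x2 i) (y2 j) (z2 l) • mul (x1 i) (mul (y1 j) (z1 l)) =
      ∑ i, ∑ j, ∑ l, ω (x1 i) (y1 j) (z1 l) • mul (mul (x2 i) (y2 j)) (z2 l)

/-- A preantipode for a coquasi-bialgebra: a `k`-linear endomorphism `S` with
(P1) `∑ S(h₁)₁h₂ ⊗ S(h₁)₂ = 1 ⊗ S(h)`, (P2) `∑ S(h₂)₁ ⊗ h₁S(h₂)₂ = S(h) ⊗ 1`,
(P3) `∑ ω(h₁ ⊗ S(h₂) ⊗ h₃) = ε(h)`. -/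
def CoquasiBialgebra.IsPreantipode {k H : Type*} [CommRing k] [AddCommGroup H] [Module k H]
    [Coalgebra k H] (B : CoquasiBialgebra k H) (S : H →ₗ[k] H) : Prop :=
  (∀ (h : H) (n : ℕ) (a b : Fin n → H) (m : Fin n → ℕ) (c d : ∀ i, Fin (m i) → H),
    Coalgebra.comul (R := k) h = ∑ i, a i ⊗ₜ[k] b i →
    (∀ i, Coalgebra.comul (R := k) (S (a i)) = ∑ p, c i p ⊗ₜ[k] d i p) →
    ∑ i, ∑ p, B.mul (c i p) (b i) ⊗ₜ[k] d i p = B.one ⊗ₜ[k] S h) ∧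
  (∀ (h : H) (n : ℕ) (a b : Fin n → H) (m : Fin n → ℕ) (c d : ∀ i, Fin (m i) → H),
    Coalgebra.comul (R := k) h = ∑ i, a i ⊗ₜ[k] b i →
    (∀ i, Coalgebra.comul (R := k) (S (b i)) = ∑ p, c i p ⊗ₜ[k] d i p) →
    ∑ i, ∑ p, c i p ⊗ₜ[k] B.mul (a i) (d i p) = S h ⊗ₜ[k] B.one) ∧
  (∀ (h : H) (n : ℕ) (a b : Fin n → H) (m : Fin n → ℕ) (c d : ∀ i, Fin (m i) → H),
    Coalgebra.comul (R := k) h = ∑ i, a i ⊗ₜ[k] b i →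
    (∀ i, Coalgebra.comul (R := k) (b i) = ∑ p, c i p ⊗ₜ[k] d i p) →
    ∑ i, ∑ p, B.ω (a i) (S (c i p)) (d i p) = Coalgebra.counit (R := k) h)

/-- Every tensor is a sum of pure tensors indexed by some `Fin m`. -/
theorem TensorProduct.exists_fin_sum_tmul {R M N : Type*} [CommSemiring R] [AddCommMonoid M]
    [AddCommMonoid N] [Module R M] [Module R N] (t : M ⊗[R] N) :
    ∃ (m : ℕ) (c : Fin m → M) (d : Fin m → N), t = ∑ p, c p ⊗ₜ[R] d p := by
  obtain ⟨s, hs⟩ := TensorProduct.exists_finset t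
  refine ⟨s.card, fun p => (s.equivFin.symm p).1.1, fun p => (s.equivFin.symm p).1.2, ?_⟩
  rw [hs, ← s.sum_coe_sort]
  exact (s.equivFin.symm.sum_comp fun x => x.1.1 ⊗ₜ[R] x.1.2).symm

theorem Coalgebra.sum_counit_smul_of_comul_eq {R C ι : Type*} [CommSemiring R]
    [AddCommMonoid C] [Module R C] [Coalgebra R C] {x : C} {s : Finset ι} {c d : ι → C}
    (hx : Coalgebra.comul (R := R) x = ∑ p ∈ s, c p ⊗ₜ[R] d p) :
    ∑ p ∈ s, Coalgebra.counit (R := R) (c p) • d p = x :=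
  Coalgebra.sum_counit_smul ⟨s, c, d, hx.symm⟩

theorem Coalgebra.sum_smul_counit_of_comul_eq {R C ι : Type*} [CommSemiring R]
    [AddCommMonoid C] [Module R C] [Coalgebra R C] {x : C} {s : Finset ι} {c d : ι → C}
    (hx : Coalgebra.comul (R := R) x = ∑ p ∈ s, c p ⊗ₜ[R] d p) :
    ∑ p ∈ s, Coalgebra.counit (R := R) (d p) • c p = x := by
  simpa [hx] using congr(_root_.TensorProduct.rid R C $(Coalgebra.lTensor_counit_comul (R := R) x))

/-- For a coquasi-bialgebra `H` over a commutative ring `k` with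
preantipode `S`, one has `∑ h₁S(h₂) = ε(S(h))·1_H = ∑ S(h₁)h₂` for all `h ∈ H`. -/
theorem preantipode_mul_id_eq {k H : Type*} [CommRing k] [AddCommGroup H] [Module k H]
    [Coalgebra k H] (B : CoquasiBialgebra k H) (S : H →ₗ[k] H) (hS : B.IsPreantipode S)
    (h : H) (n : ℕ) (a b : Fin n → H)
    (hrep : Coalgebra.comul (R := k) h = ∑ i, a i ⊗ₜ[k] b i) :
    ∑ i, B.mul (a i) (S (b i)) = Coalgebra.counit (R := k) (S h) • B.one ∧
    ∑ i, B.mul (S (a i)) (b i) = Coalgebra.counit (R := k) (S h) • B.one := by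
  choose m c d hcd using fun x => TensorProduct.exists_fin_sum_tmul (Coalgebra.comul (R := k) (S x))
  constructor
  · have key := congr(TensorProduct.lid k H ((Coalgebra.counit (R := k)).rTensor H
      $(hS.2.1 h n a b _ _ _ hrep fun i => hcd (b i))))
    simp only [map_sum, LinearMap.rTensor_tmul, TensorProduct.lid_tmul] at key
    rw [← key]
    refine Finset.sum_congr rfl fun i _ => ?_
    conv_lhs => rw [← Coalgebra.sum_counit_smul_of_comul_eq (hcd (b i))]
    simp
  · have key := congr(TensorProduct.rid k H ((Coalgebra.counit (R := k)).lTensor H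
      $(hS.1 h n a b _ _ _ hrep fun i => hcd (a i))))
    simp only [map_sum, LinearMap.lTensor_tmul, TensorProduct.rid_tmul] at key
    rw [← key]
    refine Finset.sum_congr rfl fun i _ => ?_
    conv_lhs => rw [← Coalgebra.sum_smul_counit_of_comul_eq (hcd (a i))]
    simp
end

section
/- Let k be a commutative ring and H a coquasi-bialgebra over k with preantipode S such that ε(S(h)) = ε(h) for all h ∈ H. Then S is an ordinary antipode: ∑ h₁S(h₂) = ε(h)·1_H = ∑ S(h₁)h₂ for all h ∈ H, i.e. S is a two-sided convolution inverse of the identity map of H. -/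
open scoped TensorProduct
open TensorProduct

/-- Every tensor is a finite sum of pure tensors indexed by some `Fin n`. -/
theorem TensorProduct.exists_eq_sum_fin_tmul {R M N : Type*} [CommSemiring R] [AddCommMonoid M]
    [AddCommMonoid N] [Module R M] [Module R N] (t : M ⊗[R] N) :
    ∃ (n : ℕ) (x : Fin n → M) (y : Fin n → N), t = ∑ i, x i ⊗ₜ[R] y i := by
  obtain ⟨s, rfl⟩ := TensorProduct.exists_finset t
  refine ⟨s.card, fun i => (s.equivFin.symm i).1.1, fun i => (s.equivFin.symm i).1.2, ?_⟩
  rw [Equiv.sum_comp s.equivFin.symm fun p => p.1.1 ⊗ₜ[R] p.1.2]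
  exact (Finset.sum_coe_sort s fun p => p.1 ⊗ₜ[R] p.2).symm

namespace Coalgebra

variable {R C : Type*} [CommSemiring R] [AddCommMonoid C] [Module R C] [Coalgebra R C]
  {ι : Type*} [Fintype ι] {x : C} {c d : ι → C}

theorem sum_counit_smul_of_comul_eq_s1 (hx : comul (R := R) x = ∑ i, c i ⊗ₜ[R] d i) :
    ∑ i, counit (R := R) (c i) • d i = x :=
  sum_counit_smul (R := R) (a := x) ⟨Finset.univ, c, d, hx.symm⟩

theorem sum_counit_smul_left_of_comul_eq (hx : comul (R := R) x = ∑ i, c i ⊗ₜ[R] d i) :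
    ∑ i, counit (R := R) (d i) • c i = x := by
  have h := lTensor_counit_comul (R := R) x
  rw [hx] at h
  simpa using congrArg (_root_.TensorProduct.rid R C) h

end Coalgebra

namespace CoquasiBialgebra.IsPreantipode

variable {k H : Type*} [CommRing k] [AddCommGroup H] [Module k H] [Coalgebra k H]
  {B : CoquasiBialgebra k H} {S : H →ₗ[k] H} {h : H} {n : ℕ} {a b : Fin n → H}

/-- Every preantipode satisfies `∑ h₁S(h₂) = ε(S(h))1`. -/
theorem sum_mul_apply (hS : B.IsPreantipode S)
    (hrep : Coalgebra.comul (R := k) h = ∑ i, a i ⊗ₜ[k] b i) :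
    ∑ i, B.mul (a i) (S (b i)) = Coalgebra.counit (R := k) (S h) • B.one := by
  choose m c d hcd using fun i =>
    TensorProduct.exists_eq_sum_fin_tmul (Coalgebra.comul (R := k) (S (b i)))
  have key := congr(TensorProduct.lid k H
    (LinearMap.rTensor H Coalgebra.counit $(hS.2.1 h n a b m c d hrep hcd)))
  simp only [map_sum, LinearMap.rTensor_tmul, TensorProduct.lid_tmul] at key
  rw [← key]
  refine Finset.sum_congr rfl fun i _ => ?_
  simpa only [map_sum, map_smul] using
    congrArg (B.mul (a i)) (Coalgebra.sum_counit_smul_of_comul_eq_s1 (hcd i)).symm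

/-- Every preantipode satisfies `∑ S(h₁)h₂ = ε(S(h))1`. -/
theorem sum_apply_mul (hS : B.IsPreantipode S)
    (hrep : Coalgebra.comul (R := k) h = ∑ i, a i ⊗ₜ[k] b i) :
    ∑ i, B.mul (S (a i)) (b i) = Coalgebra.counit (R := k) (S h) • B.one := by
  choose m c d hcd using fun i =>
    TensorProduct.exists_eq_sum_fin_tmul (Coalgebra.comul (R := k) (S (a i)))
  have key := congr(TensorProduct.rid k H
    (LinearMap.lTensor H Coalgebra.counit $(hS.1 h n a b m c d hrep hcd)))
  simp only [map_sum, LinearMap.lTensor_tmul, TensorProduct.rid_tmul] at key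
  rw [← key]
  refine Finset.sum_congr rfl fun i _ => ?_
  simpa only [map_sum, map_smul, LinearMap.flip_apply] using
    congrArg (B.mul.flip (b i)) (Coalgebra.sum_counit_smul_left_of_comul_eq (hcd i)).symm

end CoquasiBialgebra.IsPreantipode

/-- If `H` is a coquasi-bialgebra over a commutative ring `k` with a
preantipode `S` satisfying `ε(S(h)) = ε(h)` for all `h`, then `S` is an ordinary antipode:
`∑ h₁S(h₂) = ε(h)·1_H = ∑ S(h₁)h₂`, i.e. `S` is a two-sided convolution inverse of the
identity map of `H`. -/
theorem preantipode_is_antipode {k H : Type*} [CommRing k] [AddCommGroup H] [Module k H]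
    [Coalgebra k H] (B : CoquasiBialgebra k H) (S : H →ₗ[k] H) (hS : B.IsPreantipode S)
    (hεS : ∀ h : H, Coalgebra.counit (R := k) (S h) = Coalgebra.counit (R := k) h)
    (h : H) (n : ℕ) (a b : Fin n → H)
    (hrep : Coalgebra.comul (R := k) h = ∑ i, a i ⊗ₜ[k] b i) :
    ∑ i, B.mul (a i) (S (b i)) = Coalgebra.counit (R := k) h • B.one ∧
    ∑ i, B.mul (S (a i)) (b i) = Coalgebra.counit (R := k) h • B.one := by
  rw [← hεS h]
  exact ⟨hS.sum_mul_apply hrep, hS.sum_apply_mul hrep⟩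
end

section
/- Let k be a commutative ring, (C, Δ_C, ε_C) a k-coalgebra, and H a coquasi-bialgebra over k with preantipode S such that H is flat as a k-module. Suppose g, h : C → H are k-linear maps such that g is a coalgebra morphism (Δ_H ∘ g = (g ⊗ g) ∘ Δ_C and ε_H ∘ g = ε_C) and for all z ∈ C: ∑ h(z₂)₁ ⊗ g(z₁)h(z₂)₂ = h(z) ⊗ 1_H; ∑ h(z₁)₁ g(z₂) ⊗ h(z₁)₂ = 1_H ⊗ h(z); and ∑ ω(g(z₁) ⊗ h(z₂) ⊗ g(z₃)) = ε_C(z). Then h = S ∘ g. -/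
open scoped TensorProduct
open TensorProduct

namespace CoquasiBialgebra

open Coalgebra LinearMap WithConv

section Fork

variable {k C C' K L M : Type*} [CommRing k] [AddCommGroup C] [Module k C] [Coalgebra k C]
  [AddCommGroup C'] [Module k C'] [Coalgebra k C']
  [AddCommGroup K] [Module k K] [AddCommGroup L] [Module k L] [AddCommGroup M] [Module k M]

/-- The map `z ↦ ∑ a(z₁) ⊗ b(z₂)`. -/
noncomputable def fork (a : C →ₗ[k] K) (b : C →ₗ[k] L) : C →ₗ[k] K ⊗[k] L :=
  TensorProduct.map a b ∘ₗ comul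

lemma map_comp_fork {K' L' : Type*} [AddCommGroup K'] [Module k K'] [AddCommGroup L'] [Module k L']
    (p : K →ₗ[k] K') (q : L →ₗ[k] L') (a : C →ₗ[k] K) (b : C →ₗ[k] L) :
    TensorProduct.map p q ∘ₗ fork a b = fork (p ∘ₗ a) (q ∘ₗ b) := by
  simp [fork, TensorProduct.map_comp, LinearMap.comp_assoc]

lemma fork_comp_coalgHom (a : C →ₗ[k] K) (b : C →ₗ[k] L) (h : C' →ₗc[k] C) :
    fork a b ∘ₗ h.toLinearMap = fork (a ∘ₗ h.toLinearMap) (b ∘ₗ h.toLinearMap) := by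
  simp [fork, TensorProduct.map_comp, LinearMap.comp_assoc]

lemma assoc_comp_fork (a : C →ₗ[k] K) (b : C →ₗ[k] L) (c : C →ₗ[k] M) :
    (TensorProduct.assoc k K L M).toLinearMap ∘ₗ fork (fork a b) c = fork a (fork b c) := by
  ext z
  have h1 : fork (fork a b) c = TensorProduct.map (TensorProduct.map a b) c ∘ₗ
      (comul (R := k) (A := C)).rTensor C ∘ₗ comul := by
    simp [fork, ← LinearMap.comp_assoc, LinearMap.map_comp_rTensor]
  have h2 : fork a (fork b c) = TensorProduct.map a (TensorProduct.map b c) ∘ₗ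
      (comul (R := k) (A := C)).lTensor C ∘ₗ comul := by
    simp [fork, ← LinearMap.comp_assoc, LinearMap.map_comp_lTensor]
  rw [h1, h2, ← Coalgebra.coassoc]
  simp only [← LinearMap.comp_assoc]
  rw [TensorProduct.map_map_comp_assoc_eq]

lemma assoc_symm_comp_fork (a : C →ₗ[k] K) (b : C →ₗ[k] L) (c : C →ₗ[k] M) :
    (TensorProduct.assoc k K L M).symm.toLinearMap ∘ₗ fork a (fork b c) = fork (fork a b) c := by
  rw [← assoc_comp_fork, ← LinearMap.comp_assoc]; simp

lemma fork_map_map {K' L' : Type*} [AddCommGroup K'] [Module k K'] [AddCommGroup L'] [Module k L']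
    (a : C →ₗ[k] K) (b : C' →ₗ[k] L) (c : C →ₗ[k] K') (d : C' →ₗ[k] L') :
    fork (TensorProduct.map a b) (TensorProduct.map c d) =
      (TensorProduct.tensorTensorTensorComm k K K' L L').toLinearMap ∘ₗ
        TensorProduct.map (fork a c) (fork b d) := by
  ext x y
  simp only [fork, LinearMap.comp_apply, TensorProduct.AlgebraTensorModule.curry_apply,
    TensorProduct.curry_apply, LinearMap.restrictScalars_self, TensorProduct.comul_tmul,
    TensorProduct.map_tmul, LinearEquiv.coe_coe]
  induction comul (R := k) x with
  | zero => simp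
  | add _ _ h₁ h₂ => simp only [add_tmul, map_add, h₁, h₂]
  | tmul x₁ x₂ =>
    induction comul (R := k) y with
    | zero => simp
    | add _ _ h₁ h₂ => simp only [tmul_add, map_add, h₁, h₂]
    | tmul y₁ y₂ => simp

end Fork

section Conv

variable {k C C' A : Type*} [CommRing k] [AddCommGroup C] [Module k C] [Coalgebra k C]
  [AddCommGroup C'] [Module k C'] [Coalgebra k C']
  [CommRing A] [Algebra k A]

lemma ofConv_mul_eq (F G : WithConv (C →ₗ[k] A)) :
    (F * G).ofConv = mul' k A ∘ₗ fork F.ofConv G.ofConv := rfl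

/-- Precomposition with a coalgebra morphism, as a homomorphism of convolution monoids. -/
noncomputable def pull (h : C →ₗc[k] C') :
    WithConv (C' →ₗ[k] A) →* WithConv (C →ₗ[k] A) where
  toFun F := toConv (F.ofConv ∘ₗ h.toLinearMap)
  map_one' := by ext; simp [LinearMap.convOne_def]
  map_mul' F G := by
    rw [convMul_comp_coalgHom_distrib]

@[simp]
lemma pull_apply (h : C →ₗc[k] C') (F : WithConv (C' →ₗ[k] A)) (x : C) :
    pull h F x = F (h x) := rfl

end Conv

section ExtMul

variable {k C D A : Type*} [CommRing k] [AddCommGroup C] [Module k C]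
  [AddCommGroup D] [Module k D] [CommRing A] [Algebra k A]

/-- The external product of two linear maps into a commutative algebra. -/
noncomputable def extMul (F : WithConv (C →ₗ[k] A)) (G : WithConv (D →ₗ[k] A)) :
    WithConv (C ⊗[k] D →ₗ[k] A) :=
  toConv (mul' k A ∘ₗ TensorProduct.map F.ofConv G.ofConv)

@[simp]
lemma extMul_tmul (F : WithConv (C →ₗ[k] A)) (G : WithConv (D →ₗ[k] A)) (x : C) (y : D) :
    extMul F G (x ⊗ₜ y) = F x * G y := rfl

lemma extMul_comp_fork {C' : Type*} [AddCommGroup C'] [Module k C'] [Coalgebra k C']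
    (F : WithConv (C →ₗ[k] A)) (G : WithConv (D →ₗ[k] A)) (a : C' →ₗ[k] C) (b : C' →ₗ[k] D) :
    toConv ((extMul F G).ofConv ∘ₗ fork a b) =
      toConv (F.ofConv ∘ₗ a) * toConv (G.ofConv ∘ₗ b) := by
  apply ofConv_injective
  simp only [extMul, ofConv_mul_eq, LinearMap.comp_assoc, map_comp_fork]

variable [Coalgebra k C] [Coalgebra k D]

lemma extMul_mul_extMul (F F' : WithConv (C →ₗ[k] A)) (G G' : WithConv (D →ₗ[k] A)) :
    extMul F G * extMul F' G' = extMul (F * F') (G * G') := by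
  apply ofConv_injective
  have h := congrArg (fun X => toConv ((Algebra.TensorProduct.lmul' k (S := A)).toLinearMap ∘ₗ
    ofConv X)) (TensorProduct.map_convMul_map (f := F) (g := G) (h := F') (k := G'))
  simp only [algHom_comp_convMul_distrib] at h
  exact congrArg ofConv h

end ExtMul

section Congr

variable {k C C' D A : Type*} [CommRing k] [AddCommGroup C] [Module k C] [Coalgebra k C]
  [AddCommGroup C'] [Module k C'] [AddCommGroup D] [Module k D] [Coalgebra k D]
  [CommRing A] [Algebra k A]

lemma mul_pull_comp_congr {T : C' →ₗ[k] C} {p q : C →ₗc[k] D}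
    (h : fork .id p.toLinearMap ∘ₗ T = fork .id q.toLinearMap ∘ₗ T)
    (F : WithConv (C →ₗ[k] A)) (G : WithConv (D →ₗ[k] A)) :
    (F * pull p G).ofConv ∘ₗ T = (F * pull q G).ofConv ∘ₗ T := by
  have key (p : C →ₗc[k] D) : (F * pull p G).ofConv ∘ₗ T =
      mul' k A ∘ₗ TensorProduct.map F.ofConv G.ofConv ∘ₗ fork .id p.toLinearMap ∘ₗ T := by
    rw [← LinearMap.comp_assoc T, map_comp_fork]; rfl
  rw [key, key, h]

lemma pull_mul_comp_congr {T : C' →ₗ[k] C} {p q : C →ₗc[k] D}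
    (h : fork p.toLinearMap .id ∘ₗ T = fork q.toLinearMap .id ∘ₗ T)
    (F : WithConv (C →ₗ[k] A)) (G : WithConv (D →ₗ[k] A)) :
    (pull p G * F).ofConv ∘ₗ T = (pull q G * F).ofConv ∘ₗ T := by
  have key (p : C →ₗc[k] D) : (pull p G * F).ofConv ∘ₗ T =
      mul' k A ∘ₗ TensorProduct.map G.ofConv F.ofConv ∘ₗ fork p.toLinearMap .id ∘ₗ T := by
    rw [← LinearMap.comp_assoc T, map_comp_fork]; rfl
  rw [key, key, h]

end Congr


section CoalgebraMorphisms

variable {k H D : Type*} [CommRing k] [AddCommGroup H] [Module k H] [Coalgebra k H]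
  [AddCommGroup D] [Module k D] [Coalgebra k D]

lemma exists_comul_eq_sum (x : D) :
    ∃ (n : ℕ) (a b : Fin n → D), comul (R := k) x = ∑ i, a i ⊗ₜ[k] b i := by
  obtain ⟨s, hs⟩ := TensorProduct.exists_finset (comul (R := k) x)
  refine ⟨s.card, fun i => (s.equivFin.symm i : D × D).1,
    fun i => (s.equivFin.symm i : D × D).2, ?_⟩
  rw [hs, ← Finset.sum_coe_sort s]
  exact (Equiv.sum_comp s.equivFin.symm (fun i : s => (i : D × D).1 ⊗ₜ[k] (i : D × D).2)).symm

/-- The coalgebra morphism `x ⊗ d ↦ ε(x) d`. -/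
noncomputable def dropLeft (k H D : Type*) [CommRing k] [AddCommGroup H] [Module k H]
    [Coalgebra k H] [AddCommGroup D] [Module k D] [Coalgebra k D] : H ⊗[k] D →ₗc[k] D :=
  (Coalgebra.TensorProduct.lid k D : k ⊗[k] D →ₗc[k] D).comp
    (CoalgHom.rTensor D (counitCoalgHom k H))

@[simp]
lemma dropLeft_tmul (x : H) (d : D) : dropLeft k H D (x ⊗ₜ d) = counit (R := k) x • d := by
  simp [dropLeft]

/-- The coalgebra morphism `d ⊗ x ↦ ε(x) d`. -/
noncomputable def dropRight (k H D : Type*) [CommRing k] [AddCommGroup H] [Module k H]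
    [Coalgebra k H] [AddCommGroup D] [Module k D] [Coalgebra k D] : D ⊗[k] H →ₗc[k] D :=
  (Coalgebra.TensorProduct.rid k k D : D ⊗[k] k →ₗc[k] D).comp
    (CoalgHom.lTensor D (counitCoalgHom k H))

@[simp]
lemma dropRight_tmul (x : H) (d : D) : dropRight k H D (d ⊗ₜ x) = counit (R := k) x • d := by
  simp [dropRight]

/-- Apply a coalgebra morphism `H ⊗ H → H` to the first two factors of `H ⊗ (H ⊗ D)`. -/
noncomputable def mergeHead (p : H ⊗[k] H →ₗc[k] H) (D : Type*) [AddCommGroup D] [Module k D]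
    [Coalgebra k D] : H ⊗[k] (H ⊗[k] D) →ₗc[k] H ⊗[k] D :=
  (CoalgHom.rTensor D p).comp ((Coalgebra.TensorProduct.assoc k k H H D).symm :
    H ⊗[k] (H ⊗[k] D) →ₗc[k] (H ⊗[k] H) ⊗[k] D)

@[simp]
lemma mergeHead_tmul (p : H ⊗[k] H →ₗc[k] H) (x y : H) (d : D) :
    mergeHead p D (x ⊗ₜ (y ⊗ₜ d)) = p (x ⊗ₜ y) ⊗ₜ d := by
  simp [mergeHead]

variable (B : CoquasiBialgebra k H)

/-- The multiplication as a coalgebra morphism. -/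
noncomputable def mulHom : H ⊗[k] H →ₗc[k] H where
  toLinearMap := TensorProduct.lift B.mul
  counit_comp := by ext x y; simp [B.counit_mul, mul_comm]
  map_comp_comul := by
    ext x y
    obtain ⟨n, x1, x2, hx⟩ := exists_comul_eq_sum (k := k) x
    obtain ⟨m, y1, y2, hy⟩ := exists_comul_eq_sum (k := k) y
    simpa [B.comul_mul x y n m x1 x2 y1 y2 hx hy, hx, hy, sum_tmul, tmul_sum] using Finset.sum_comm

@[simp]
lemma mulHom_tmul (x y : H) : B.mulHom (x ⊗ₜ y) = B.mul x y := rfl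

/-- The unit as a coalgebra morphism. -/
noncomputable def oneHom : k →ₗc[k] H where
  toLinearMap := LinearMap.toSpanSingleton k H B.one
  counit_comp := by ext; simp [B.counit_one]
  map_comp_comul := by ext; simp [B.comul_one]

@[simp]
lemma oneHom_apply (c : k) : B.oneHom c = c • B.one := rfl

/-- The coalgebra morphism `d ↦ 1 ⊗ d`. -/
noncomputable def insertOne (D : Type*) [AddCommGroup D] [Module k D] [Coalgebra k D] :
    D →ₗc[k] H ⊗[k] D :=
  (CoalgHom.rTensor D B.oneHom).comp ((Coalgebra.TensorProduct.lid k D).symm : D →ₗc[k] k ⊗[k] D)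

@[simp]
lemma insertOne_apply (d : D) : B.insertOne D d = B.one ⊗ₜ[k] d := by
  simp [insertOne]

/-- The coalgebra morphism `x ⊗ y ↦ ε(x)ε(y) 1`. -/
noncomputable def unitHom : H ⊗[k] H →ₗc[k] H :=
  B.oneHom.comp (counitCoalgHom k (H ⊗[k] H))

@[simp]
lemma unitHom_tmul (x y : H) :
    B.unitHom (x ⊗ₜ y) = (counit (R := k) y * counit (R := k) x) • B.one := rfl

end CoalgebraMorphisms

section Reassociator

variable {k H A : Type*} [CommRing k] [AddCommGroup H] [Module k H]
  [CommRing A] [Algebra k A]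

/-- A trilinear form, viewed as an `A`-valued map on the triple tensor product. -/
noncomputable def trilin (A : Type*) [CommRing A] [Algebra k A] (F : H →ₗ[k] H →ₗ[k] H →ₗ[k] k) :
    WithConv (H ⊗[k] (H ⊗[k] H) →ₗ[k] A) :=
  toConv (Algebra.linearMap k A ∘ₗ TensorProduct.lift (TensorProduct.lift F) ∘ₗ
    (TensorProduct.assoc k H H H).symm.toLinearMap)

@[simp]
lemma trilin_tmul (F : H →ₗ[k] H →ₗ[k] H →ₗ[k] k) (x y z : H) :
    trilin A F (x ⊗ₜ (y ⊗ₜ z)) = algebraMap k A (F x y z) := by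
  simp [trilin]

variable [Coalgebra k H]

lemma convMul_tmul_tmul {F G : WithConv (H ⊗[k] (H ⊗[k] H) →ₗ[k] A)} {x y z : H} {n m p : ℕ}
    {x1 x2 : Fin n → H} {y1 y2 : Fin m → H} {z1 z2 : Fin p → H}
    (hx : comul (R := k) x = ∑ i, x1 i ⊗ₜ[k] x2 i) (hy : comul (R := k) y = ∑ j, y1 j ⊗ₜ[k] y2 j)
    (hz : comul (R := k) z = ∑ l, z1 l ⊗ₜ[k] z2 l) :
    (F * G) (x ⊗ₜ (y ⊗ₜ z)) = ∑ i, ∑ j, ∑ l,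
      F (x1 i ⊗ₜ (y1 j ⊗ₜ z1 l)) * G (x2 i ⊗ₜ (y2 j ⊗ₜ z2 l)) := by
  simp only [convMul_apply, TensorProduct.comul_tmul, hx, hy, hz, sum_tmul, tmul_sum, map_sum,
    AlgebraTensorModule.tensorTensorTensorComm_tmul, map_tmul, mul'_apply]
  rw [Finset.sum_comm_cycle]
  refine Finset.sum_congr rfl fun i _ => Finset.sum_comm

variable (B : CoquasiBialgebra k H)

lemma trilin_ω_mul_trilin_ωInv : trilin A B.ω * trilin A B.ωInv = 1 := by
  ext x y z
  obtain ⟨n, x1, x2, hx⟩ := exists_comul_eq_sum (k := k) x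
  obtain ⟨m, y1, y2, hy⟩ := exists_comul_eq_sum (k := k) y
  obtain ⟨p, z1, z2, hz⟩ := exists_comul_eq_sum (k := k) z
  have h := congrArg (algebraMap k A) (B.ω_conv_inv x y z n m p x1 x2 y1 y2 z1 z2 hx hy hz).1
  have h' := convMul_tmul_tmul (F := trilin A B.ω) (G := trilin A B.ωInv) hx hy hz
  simp only [trilin_tmul, ← map_mul, ← map_sum, h] at h'
  simpa [mul_comm, mul_left_comm] using h'

lemma trilin_ωInv_mul_trilin_ω : trilin A B.ωInv * trilin A B.ω = 1 := by
  ext x y z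
  obtain ⟨n, x1, x2, hx⟩ := exists_comul_eq_sum (k := k) x
  obtain ⟨m, y1, y2, hy⟩ := exists_comul_eq_sum (k := k) y
  obtain ⟨p, z1, z2, hz⟩ := exists_comul_eq_sum (k := k) z
  have h := congrArg (algebraMap k A) (B.ω_conv_inv x y z n m p x1 x2 y1 y2 z1 z2 hx hy hz).2
  have h' := convMul_tmul_tmul (F := trilin A B.ωInv) (G := trilin A B.ω) hx hy hz
  simp only [trilin_tmul, ← map_mul, ← map_sum, h] at h'
  simpa [mul_comm, mul_left_comm] using h'

lemma pull_mul_trilin_ω (j : H →ₗ[k] A) :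
    pull (B.mulHom.comp (CoalgHom.lTensor H B.mulHom)) (toConv j) * trilin A B.ω =
      trilin A B.ω * pull (B.mulHom.comp (mergeHead B.mulHom H)) (toConv j) := by
  ext x y z
  obtain ⟨n, x1, x2, hx⟩ := exists_comul_eq_sum (k := k) x
  obtain ⟨m, y1, y2, hy⟩ := exists_comul_eq_sum (k := k) y
  obtain ⟨p, z1, z2, hz⟩ := exists_comul_eq_sum (k := k) z
  have h := congrArg j (B.quasi_assoc x y z n m p x1 x2 y1 y2 z1 z2 hx hy hz)
  simp only [map_sum, map_smul, Algebra.smul_def] at h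
  refine (convMul_tmul_tmul hx hy hz).trans (Eq.trans ?_ (convMul_tmul_tmul hx hy hz).symm)
  simpa [mul_comm] using h

end Reassociator

section Cocycle

variable {k H A D : Type*} [CommRing k] [AddCommGroup H] [Module k H] [Coalgebra k H]
  [AddCommGroup D] [Module k D] [Coalgebra k D] [CommRing A] [Algebra k A]

lemma sum_counit_smul {x : H} {n : ℕ} {a b : Fin n → H}
    (hx : comul (R := k) x = ∑ i, a i ⊗ₜ[k] b i) : ∑ i, counit (R := k) (a i) • b i = x := by
  have h := congrArg (TensorProduct.lid k H) (Coalgebra.rTensor_counit_comul (R := k) x)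
  simpa [hx] using h

lemma sum_counit_smul' {x : H} {n : ℕ} {a b : Fin n → H}
    (hx : comul (R := k) x = ∑ i, a i ⊗ₜ[k] b i) : ∑ i, counit (R := k) (b i) • a i = x := by
  have h := congrArg (TensorProduct.rid k H) (Coalgebra.lTensor_counit_comul (R := k) x)
  simpa [hx] using h

lemma pull_dropLeft_mul_tmul (F : WithConv (D →ₗ[k] A)) (G : WithConv (H ⊗[k] D →ₗ[k] A))
    (x : H) (v : D) :
    (pull (dropLeft k H D) F * G) (x ⊗ₜ v) =
      (F * toConv (G.ofConv ∘ₗ TensorProduct.mk k H D x)) v := by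
  obtain ⟨n, x1, x2, hx⟩ := exists_comul_eq_sum (k := k) x
  obtain ⟨m, v1, v2, hv⟩ := exists_comul_eq_sum (k := k) v
  simp only [convMul_apply, TensorProduct.comul_tmul, hx, hv, sum_tmul, tmul_sum, map_sum,
    AlgebraTensorModule.tensorTensorTensorComm_tmul, map_tmul, mul'_apply]
  refine Finset.sum_congr rfl fun j _ => ?_
  conv_rhs => rw [← sum_counit_smul hx]
  simp [Finset.mul_sum]

lemma convMul_tmul_tmul_tmul {F G : WithConv (H ⊗[k] (H ⊗[k] (H ⊗[k] H)) →ₗ[k] A)}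
    {x y z w : H} {n m p q : ℕ} {x1 x2 : Fin n → H} {y1 y2 : Fin m → H} {z1 z2 : Fin p → H}
    {w1 w2 : Fin q → H} (hx : comul (R := k) x = ∑ i, x1 i ⊗ₜ[k] x2 i)
    (hy : comul (R := k) y = ∑ j, y1 j ⊗ₜ[k] y2 j) (hz : comul (R := k) z = ∑ l, z1 l ⊗ₜ[k] z2 l)
    (hw : comul (R := k) w = ∑ r, w1 r ⊗ₜ[k] w2 r) :
    (F * G) (x ⊗ₜ (y ⊗ₜ (z ⊗ₜ w))) = ∑ i, ∑ j, ∑ l, ∑ r,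
      F (x1 i ⊗ₜ (y1 j ⊗ₜ (z1 l ⊗ₜ w1 r))) * G (x2 i ⊗ₜ (y2 j ⊗ₜ (z2 l ⊗ₜ w2 r))) := by
  simp only [convMul_apply, TensorProduct.comul_tmul, hx, hy, hz, hw, sum_tmul, tmul_sum, map_sum,
    AlgebraTensorModule.tensorTensorTensorComm_tmul, map_tmul, mul'_apply]
  rw [Finset.sum_comm_cycle]
  simp_rw [Finset.sum_comm_cycle (s := (Finset.univ : Finset (Fin q)))]
  rw [Finset.sum_comm]
  exact Finset.sum_congr rfl fun i _ => Finset.sum_congr rfl fun j _ => Finset.sum_comm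

lemma mul_pull_dropRight_tmul (G : WithConv (H ⊗[k] (H ⊗[k] (H ⊗[k] H)) →ₗ[k] A))
    (F : WithConv (H ⊗[k] (H ⊗[k] H) →ₗ[k] A)) (x y z w : H) :
    (G * pull (CoalgHom.lTensor H (CoalgHom.lTensor H (dropRight k H H))) F)
        (x ⊗ₜ (y ⊗ₜ (z ⊗ₜ w))) =
      (toConv (G.ofConv ∘ₗ lTensor H (lTensor H ((TensorProduct.mk k H H).flip w))) * F)
        (x ⊗ₜ (y ⊗ₜ z)) := by
  obtain ⟨n, x1, x2, hx⟩ := exists_comul_eq_sum (k := k) x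
  obtain ⟨m, y1, y2, hy⟩ := exists_comul_eq_sum (k := k) y
  obtain ⟨p, z1, z2, hz⟩ := exists_comul_eq_sum (k := k) z
  obtain ⟨q, w1, w2, hw⟩ := exists_comul_eq_sum (k := k) w
  rw [convMul_tmul_tmul hx hy hz, convMul_tmul_tmul_tmul hx hy hz hw]
  refine Finset.sum_congr rfl fun i _ => Finset.sum_congr rfl fun j _ =>
    Finset.sum_congr rfl fun l _ => ?_
  simp only [comp_apply, lTensor_tmul, flip_apply, mk_apply]
  conv_rhs => rw [← sum_counit_smul' hw]
  simp [tmul_sum, Finset.sum_mul]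

variable (B : CoquasiBialgebra k H)

lemma cocycle_trilin :
    pull (CoalgHom.lTensor H (CoalgHom.lTensor H B.mulHom)) (trilin A B.ω) *
        pull (mergeHead B.mulHom (H ⊗[k] H)) (trilin A B.ω) =
      pull (dropLeft k H (H ⊗[k] (H ⊗[k] H))) (trilin A B.ω) *
        (pull (CoalgHom.lTensor H (mergeHead B.mulHom H)) (trilin A B.ω) *
          pull (CoalgHom.lTensor H (CoalgHom.lTensor H (dropRight k H H))) (trilin A B.ω)) := by
  ext x y z w
  obtain ⟨nx, x1, x2, hx⟩ := exists_comul_eq_sum (k := k) x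
  obtain ⟨ny, y1, y2, hy⟩ := exists_comul_eq_sum (k := k) y
  obtain ⟨nz, z1, z2, hz⟩ := exists_comul_eq_sum (k := k) z
  obtain ⟨nw, w1, w2, hw⟩ := exists_comul_eq_sum (k := k) w
  choose my y21 y22 hy' using fun j => exists_comul_eq_sum (k := k) (y2 j)
  choose mz z21 z22 hz' using fun l => exists_comul_eq_sum (k := k) (z2 l)
  have h := congrArg (algebraMap k A) (B.cocycle x y z w nx ny nz nw x1 x2 y1 y2 z1 z2 w1 w2
    my y21 y22 mz z21 z22 hx hy hz hw hy' hz')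
  simp only [map_sum, map_mul] at h
  refine Eq.trans ?_ (h.trans ?_)
  · refine (convMul_tmul_tmul_tmul hx hy hz hw).trans ?_
    simp
  · refine Eq.trans ?_ (pull_dropLeft_mul_tmul _ _ x _).symm
    refine Eq.trans ?_ (convMul_tmul_tmul hy hz hw).symm
    have key (j l r) := (mul_pull_dropRight_tmul
        (pull (CoalgHom.lTensor H (mergeHead B.mulHom H)) (trilin A B.ω)) (trilin A B.ω)
        x (y2 j) (z2 l) (w2 r)).trans (convMul_tmul_tmul hx (hy' j) (hz' l))
    simp only [comp_apply, mk_apply, key, Finset.mul_sum]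
    rw [Finset.sum_comm]
    refine Finset.sum_congr rfl fun j _ => ?_
    rw [Finset.sum_comm_cycle]
    refine Finset.sum_congr rfl fun l _ => ?_
    refine Eq.trans (Finset.sum_congr rfl fun i _ => Finset.sum_comm_cycle) ?_
    rw [Finset.sum_comm]
    simp [mul_assoc]

end Cocycle

section Unit

variable {k H : Type*} [CommRing k] [AddCommGroup H] [Module k H] [Coalgebra k H]
  (B : CoquasiBialgebra k H)

lemma ω_apply_one (x y : H) :
    B.ω x y B.one = counit (R := k) x * counit (R := k) y := by
  have h := congrArg (pull (CoalgHom.lTensor H (CoalgHom.lTensor H (B.insertOne H))))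
    (B.cocycle_trilin (A := k))
  simp only [map_mul] at h
  have h1 : pull (CoalgHom.lTensor H (CoalgHom.lTensor H (B.insertOne H)))
      (pull (CoalgHom.lTensor H (CoalgHom.lTensor H B.mulHom)) (trilin k B.ω)) =
      trilin k B.ω := by
    ext; simp [B.one_mul]
  have h2 : pull (CoalgHom.lTensor H (CoalgHom.lTensor H (B.insertOne H)))
      (pull (mergeHead B.mulHom (H ⊗[k] H)) (trilin k B.ω)) = 1 := by
    ext; simp [B.ω_one, B.counit_mul, mul_comm, mul_left_comm]
  have h3 : pull (CoalgHom.lTensor H (CoalgHom.lTensor H (B.insertOne H)))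
      (pull (dropLeft k H (H ⊗[k] (H ⊗[k] H))) (trilin k B.ω)) = 1 := by
    ext; simp [B.ω_one, mul_comm]
  have h4 : pull (CoalgHom.lTensor H (CoalgHom.lTensor H (B.insertOne H)))
      (pull (CoalgHom.lTensor H (mergeHead B.mulHom H)) (trilin k B.ω)) =
      trilin k B.ω := by
    ext; simp [B.mul_one]
  rw [h1, h2, h3, h4, _root_.mul_one, _root_.one_mul] at h
  have h5 := congrArg (fun X => (trilin k B.ωInv * X) (x ⊗ₜ (y ⊗ₜ B.one))) h
  simp only [← _root_.mul_assoc, trilin_ωInv_mul_trilin_ω, _root_.one_mul] at h5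
  simpa [B.counit_one, mul_comm] using h5.symm

lemma ω_one_apply (x y : H) :
    B.ω B.one x y = counit (R := k) x * counit (R := k) y := by
  have h := congrArg (pull (CoalgHom.lTensor H (B.insertOne (H ⊗[k] H))))
    (B.cocycle_trilin (A := k))
  simp only [map_mul] at h
  have h1 : pull (CoalgHom.lTensor H (B.insertOne (H ⊗[k] H)))
      (pull (CoalgHom.lTensor H (CoalgHom.lTensor H B.mulHom)) (trilin k B.ω)) = 1 := by
    ext; simp [B.ω_one, B.counit_mul, mul_comm]
  have h2 : pull (CoalgHom.lTensor H (B.insertOne (H ⊗[k] H)))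
      (pull (mergeHead B.mulHom (H ⊗[k] H)) (trilin k B.ω)) = trilin k B.ω := by
    ext; simp [B.mul_one]
  have h3 : pull (CoalgHom.lTensor H (B.insertOne (H ⊗[k] H)))
      (pull (CoalgHom.lTensor H (mergeHead B.mulHom H)) (trilin k B.ω)) = trilin k B.ω := by
    ext; simp [B.one_mul]
  have h4 : pull (CoalgHom.lTensor H (B.insertOne (H ⊗[k] H)))
      (pull (CoalgHom.lTensor H (CoalgHom.lTensor H (dropRight k H H))) (trilin k B.ω)) = 1 := by
    ext; simp [B.ω_one, mul_comm, mul_left_comm]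
  rw [h1, h2, h3, h4, _root_.mul_one, _root_.one_mul] at h
  have h5 := congrArg (fun X => (X * trilin k B.ωInv) (B.one ⊗ₜ (x ⊗ₜ y))) h
  simp only [_root_.mul_assoc, trilin_ω_mul_trilin_ωInv, _root_.mul_one] at h5
  simpa [B.counit_one, mul_comm] using h5.symm

end Unit

section Collapse

variable {k H C D : Type*} [CommRing k] [AddCommGroup H] [Module k H] [Coalgebra k H]
  [AddCommGroup C] [Module k C] [Coalgebra k C] [AddCommGroup D] [Module k D] [Coalgebra k D]

lemma fork_id_lTensor_comp_fork {E : Type*} [AddCommGroup E] [Module k E] [Coalgebra k E]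
    (p : D →ₗc[k] E) (a : C →ₗ[k] H) (t : C →ₗ[k] D) :
    fork .id (CoalgHom.lTensor H p).toLinearMap ∘ₗ fork a t =
      (TensorProduct.tensorTensorTensorComm k H H D E).toLinearMap ∘ₗ
        fork (fork .id .id ∘ₗ a) (fork .id p.toLinearMap ∘ₗ t) := by
  have h : fork .id (CoalgHom.lTensor H p).toLinearMap =
      fork (TensorProduct.map (.id : H →ₗ[k] H) (.id : D →ₗ[k] D))
        (TensorProduct.map .id p.toLinearMap) := by
    rw [TensorProduct.map_id]; rfl
  rw [h, fork_map_map, LinearMap.comp_assoc, map_comp_fork]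

lemma fork_lTensor_id_comp_fork {E : Type*} [AddCommGroup E] [Module k E] [Coalgebra k E]
    (p : D →ₗc[k] E) (a : C →ₗ[k] H) (t : C →ₗ[k] D) :
    fork (CoalgHom.lTensor H p).toLinearMap .id ∘ₗ fork a t =
      (TensorProduct.tensorTensorTensorComm k H H E D).toLinearMap ∘ₗ
        fork (fork .id .id ∘ₗ a) (fork p.toLinearMap .id ∘ₗ t) := by
  have h : fork (CoalgHom.lTensor H p).toLinearMap .id =
      fork (TensorProduct.map .id p.toLinearMap)
        (TensorProduct.map (.id : H →ₗ[k] H) (.id : D →ₗ[k] D)) := by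
    rw [TensorProduct.map_id]; rfl
  rw [h, fork_map_map, LinearMap.comp_assoc, map_comp_fork]

lemma fork_id_mergeHead_comp_fork (p : H ⊗[k] H →ₗc[k] H) (a b : C →ₗ[k] H) (t : C →ₗ[k] D) :
    fork .id (mergeHead p D).toLinearMap ∘ₗ fork a (fork b t) =
      TensorProduct.map (TensorProduct.assoc k H H D).toLinearMap .id ∘ₗ
      (TensorProduct.tensorTensorTensorComm k (H ⊗[k] H) H D D).toLinearMap ∘ₗ
        fork (fork .id p.toLinearMap ∘ₗ fork a b) (fork .id .id ∘ₗ t) := by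
  have h : fork .id (mergeHead p D).toLinearMap ∘ₗ (TensorProduct.assoc k H H D).toLinearMap =
      TensorProduct.map (TensorProduct.assoc k H H D).toLinearMap .id ∘ₗ
      fork (TensorProduct.map (.id : H ⊗[k] H →ₗ[k] H ⊗[k] H) (.id : D →ₗ[k] D))
        (TensorProduct.map p.toLinearMap .id) := by
    refine (fork_comp_coalgHom _ _ (Coalgebra.TensorProduct.assoc k k H H D).toCoalgHom).trans ?_
    rw [map_comp_fork, TensorProduct.map_id]
    congr 1
    ext; simp
  rw [← assoc_comp_fork, ← LinearMap.comp_assoc, h, fork_map_map]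
  simp only [LinearMap.comp_assoc, map_comp_fork]

lemma fork_mergeHead_id_comp_fork (p : H ⊗[k] H →ₗc[k] H) (a b : C →ₗ[k] H) (t : C →ₗ[k] D) :
    fork (mergeHead p D).toLinearMap .id ∘ₗ fork a (fork b t) =
      TensorProduct.map .id (TensorProduct.assoc k H H D).toLinearMap ∘ₗ
      (TensorProduct.tensorTensorTensorComm k H (H ⊗[k] H) D D).toLinearMap ∘ₗ
        fork (fork p.toLinearMap .id ∘ₗ fork a b) (fork .id .id ∘ₗ t) := by
  have h : fork (mergeHead p D).toLinearMap .id ∘ₗ (TensorProduct.assoc k H H D).toLinearMap =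
      TensorProduct.map .id (TensorProduct.assoc k H H D).toLinearMap ∘ₗ
      fork (TensorProduct.map p.toLinearMap .id)
        (TensorProduct.map (.id : H ⊗[k] H →ₗ[k] H ⊗[k] H) (.id : D →ₗ[k] D)) := by
    refine (fork_comp_coalgHom _ _ (Coalgebra.TensorProduct.assoc k k H H D).toCoalgHom).trans ?_
    rw [map_comp_fork, TensorProduct.map_id]
    congr 1
    ext; simp
  rw [← assoc_comp_fork, ← LinearMap.comp_assoc, h, fork_map_map]
  simp only [LinearMap.comp_assoc, map_comp_fork]

variable (B : CoquasiBialgebra k H)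

lemma fork_id_mulHom_comp_fork (g : C →ₗc[k] H) (f : C →ₗ[k] H)
    (hyp : ∀ (z : C) (n : ℕ) (c d : Fin n → C) (m : Fin n → ℕ) (e e' : ∀ i, Fin (m i) → H),
      comul (R := k) z = ∑ i, c i ⊗ₜ[k] d i →
      (∀ i, comul (R := k) (f (d i)) = ∑ p, e i p ⊗ₜ[k] e' i p) →
      ∑ i, ∑ p, e i p ⊗ₜ[k] B.mul (g (c i)) (e' i p) = f z ⊗ₜ[k] B.one) :
    fork .id B.mulHom.toLinearMap ∘ₗ fork g.toLinearMap f =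
      fork .id B.unitHom.toLinearMap ∘ₗ fork g.toLinearMap f := by
  let Φ : H ⊗[k] H →ₗ[k] H ⊗[k] H := lTensor H B.mulHom.toLinearMap ∘ₗ
    (TensorProduct.leftComm k H H H).toLinearMap ∘ₗ lTensor H comul
  have hΦ : Φ ∘ₗ fork g.toLinearMap f = (TensorProduct.mk k H H).flip B.one ∘ₗ f := by
    ext z
    obtain ⟨n, c, d, hz⟩ := exists_comul_eq_sum (k := k) z
    choose m e e' he using fun i => exists_comul_eq_sum (k := k) (f (d i))
    simpa [Φ, fork, hz, he, tmul_sum] using hyp z n c d m e e' hz he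
  have hmul : fork .id B.mulHom.toLinearMap = (TensorProduct.assoc k H H H).symm.toLinearMap ∘ₗ
      TensorProduct.map .id Φ ∘ₗ (TensorProduct.assoc k H H H).toLinearMap ∘ₗ
        TensorProduct.map comul .id := by
    ext x y
    obtain ⟨n, x1, x2, hx⟩ := exists_comul_eq_sum (k := k) x
    obtain ⟨m, y1, y2, hy⟩ := exists_comul_eq_sum (k := k) y
    simpa [Φ, fork, hx, hy, tmul_sum, sum_tmul] using Finset.sum_comm
  have hone : fork .id B.unitHom.toLinearMap = (TensorProduct.assoc k H H H).symm.toLinearMap ∘ₗ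
      TensorProduct.map .id ((TensorProduct.mk k H H).flip B.one) := by
    ext x y
    obtain ⟨n, x1, x2, hx⟩ := exists_comul_eq_sum (k := k) x
    obtain ⟨m, y1, y2, hy⟩ := exists_comul_eq_sum (k := k) y
    conv_rhs => rw [← sum_counit_smul' hx, ← sum_counit_smul' hy]
    simp [fork, hx, hy, tmul_sum, sum_tmul, smul_tmul', mul_smul, Finset.smul_sum]
  have hg : comul ∘ₗ g.toLinearMap = fork g.toLinearMap g.toLinearMap := g.map_comp_comul.symm
  rw [hmul, hone]
  simp only [LinearMap.comp_assoc, map_comp_fork, hg, assoc_comp_fork, LinearMap.id_comp, hΦ]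

lemma fork_mulHom_id_comp_fork (g : C →ₗc[k] H) (f : C →ₗ[k] H)
    (hyp : ∀ (z : C) (n : ℕ) (c d : Fin n → C) (m : Fin n → ℕ) (e e' : ∀ i, Fin (m i) → H),
      comul (R := k) z = ∑ i, c i ⊗ₜ[k] d i →
      (∀ i, comul (R := k) (f (c i)) = ∑ p, e i p ⊗ₜ[k] e' i p) →
      ∑ i, ∑ p, B.mul (e i p) (g (d i)) ⊗ₜ[k] e' i p = B.one ⊗ₜ[k] f z) :
    fork B.mulHom.toLinearMap .id ∘ₗ fork f g.toLinearMap =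
      fork B.unitHom.toLinearMap .id ∘ₗ fork f g.toLinearMap := by
  let Ψ : H ⊗[k] H →ₗ[k] H ⊗[k] H := rTensor H B.mulHom.toLinearMap ∘ₗ
    (TensorProduct.rightComm k H H H).toLinearMap ∘ₗ rTensor H comul
  have hΨ : Ψ ∘ₗ fork f g.toLinearMap = TensorProduct.mk k H H B.one ∘ₗ f := by
    ext z
    obtain ⟨n, c, d, hz⟩ := exists_comul_eq_sum (k := k) z
    choose m e e' he using fun i => exists_comul_eq_sum (k := k) (f (c i))
    simpa [Ψ, fork, hz, he, sum_tmul] using hyp z n c d m e e' hz he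
  have hmul : fork B.mulHom.toLinearMap .id = (TensorProduct.assoc k H H H).toLinearMap ∘ₗ
      TensorProduct.map Ψ .id ∘ₗ (TensorProduct.assoc k H H H).symm.toLinearMap ∘ₗ
        TensorProduct.map .id comul := by
    ext x y
    obtain ⟨n, x1, x2, hx⟩ := exists_comul_eq_sum (k := k) x
    obtain ⟨m, y1, y2, hy⟩ := exists_comul_eq_sum (k := k) y
    simp [Ψ, fork, hx, hy, tmul_sum, sum_tmul]
  have hone : fork B.unitHom.toLinearMap .id = (TensorProduct.assoc k H H H).toLinearMap ∘ₗ
      TensorProduct.map (TensorProduct.mk k H H B.one) .id := by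
    ext x y
    obtain ⟨n, x1, x2, hx⟩ := exists_comul_eq_sum (k := k) x
    obtain ⟨m, y1, y2, hy⟩ := exists_comul_eq_sum (k := k) y
    conv_rhs => rw [← sum_counit_smul hx, ← sum_counit_smul hy]
    simp [fork, hx, hy, tmul_sum, sum_tmul, smul_tmul', mul_smul, Finset.smul_sum]
  have hg : comul ∘ₗ g.toLinearMap = fork g.toLinearMap g.toLinearMap := g.map_comp_comul.symm
  rw [hmul, hone]
  simp only [LinearMap.comp_assoc, map_comp_fork, hg, assoc_symm_comp_fork, LinearMap.id_comp, hΨ]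

lemma trilin_comp_fork {A : Type*} [CommRing A] [Algebra k A] (g : C →ₗc[k] H) (f : C →ₗ[k] H)
    (hyp : ∀ (z : C) (n : ℕ) (c d : Fin n → C) (m : Fin n → ℕ) (d1 d2 : ∀ i, Fin (m i) → C),
      comul (R := k) z = ∑ i, c i ⊗ₜ[k] d i →
      (∀ i, comul (R := k) (d i) = ∑ p, d1 i p ⊗ₜ[k] d2 i p) →
      ∑ i, ∑ p, B.ω (g (c i)) (f (d1 i p)) (g (d2 i p)) = counit (R := k) z) :
    toConv ((trilin A B.ω).ofConv ∘ₗ fork g.toLinearMap (fork f g.toLinearMap)) = 1 := by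
  ext z
  obtain ⟨n, c, d, hz⟩ := exists_comul_eq_sum (k := k) z
  choose m d1 d2 hd using fun i => exists_comul_eq_sum (k := k) (d i)
  simpa [fork, hz, hd, tmul_sum] using congrArg (algebraMap k A) (hyp z n c d m d1 d2 hz hd)

end Collapse

section Main

variable {k H C A : Type*} [CommRing k] [AddCommGroup H] [Module k H] [Coalgebra k H]
  [AddCommGroup C] [Module k C] [Coalgebra k C] [CommRing A] [Algebra k A]

/-- The reassociation `x ⊗ (y ⊗ (z ⊗ d)) ↦ (x ⊗ (y ⊗ z)) ⊗ d` as a coalgebra morphism. -/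
noncomputable def regroup (k H D : Type*) [CommRing k] [AddCommGroup H] [Module k H]
    [Coalgebra k H] [AddCommGroup D] [Module k D] [Coalgebra k D] :
    H ⊗[k] (H ⊗[k] (H ⊗[k] D)) →ₗc[k] (H ⊗[k] (H ⊗[k] H)) ⊗[k] D :=
  ((Coalgebra.TensorProduct.assoc k k H (H ⊗[k] H) D).symm.toCoalgHom).comp
    (CoalgHom.lTensor H (Coalgebra.TensorProduct.assoc k k H H D).symm.toCoalgHom)

@[simp]
lemma regroup_tmul {D : Type*} [AddCommGroup D] [Module k D] [Coalgebra k D] (x y z : H) (d : D) :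
    regroup k H D (x ⊗ₜ (y ⊗ₜ (z ⊗ₜ d))) = (x ⊗ₜ (y ⊗ₜ z)) ⊗ₜ d := by
  simp [regroup]

lemma regroup_comp_fork {D : Type*} [AddCommGroup D] [Module k D] [Coalgebra k D]
    (a b c : C →ₗ[k] H) (t : C →ₗ[k] D) :
    (regroup k H D).toLinearMap ∘ₗ fork a (fork b (fork c t)) = fork (fork a (fork b c)) t := by
  have h : (regroup k H D).toLinearMap =
      (TensorProduct.assoc k H (H ⊗[k] H) D).symm.toLinearMap ∘ₗ
        TensorProduct.map .id (TensorProduct.assoc k H H D).symm.toLinearMap := by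
    ext; simp
  rw [h, LinearMap.comp_assoc, map_comp_fork, assoc_symm_comp_fork, assoc_symm_comp_fork]
  simp

lemma one_ofConv_comp_coalgHom (g : C →ₗc[k] H) :
    toConv ((1 : WithConv (H →ₗ[k] A)).ofConv ∘ₗ g.toLinearMap) = 1 :=
  map_one (pull g)

variable (B : CoquasiBialgebra k H)

/-- The product of `ω(y ⊗ z ⊗ w)`, `j(yz)` and `ω(x ⊗ y ⊗ z)`. -/
noncomputable def sandwich (j : H →ₗ[k] A) :
    WithConv (H ⊗[k] (H ⊗[k] (H ⊗[k] H)) →ₗ[k] A) :=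
  pull (dropLeft k H (H ⊗[k] (H ⊗[k] H))) (trilin A B.ω) *
    pull (B.mulHom.comp ((CoalgHom.lTensor H (dropRight k H H)).comp
      (dropLeft k H (H ⊗[k] (H ⊗[k] H))))) (toConv j) *
    pull (CoalgHom.lTensor H (CoalgHom.lTensor H (dropRight k H H))) (trilin A B.ω)

lemma pull_unitHom_second_sandwich (j : H →ₗ[k] A) :
    pull (CoalgHom.lTensor H (mergeHead B.unitHom (H ⊗[k] H))) (B.sandwich j) =
      pull (regroup k H (H ⊗[k] H)) (extMul 1 (extMul (toConv j) 1)) := by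
  have h1 : pull (CoalgHom.lTensor H (mergeHead B.unitHom (H ⊗[k] H)))
      (pull (dropLeft k H (H ⊗[k] (H ⊗[k] H))) (trilin A B.ω)) = 1 := by
    ext; simp [B.ω_one_apply, mul_comm, mul_left_comm, Algebra.smul_def]
  have h2 : pull (CoalgHom.lTensor H (mergeHead B.unitHom (H ⊗[k] H)))
      (pull (CoalgHom.lTensor H (CoalgHom.lTensor H (dropRight k H H))) (trilin A B.ω)) = 1 := by
    ext; simp [B.ω_one, mul_comm, mul_left_comm, Algebra.smul_def]
  simp only [sandwich, map_mul, h1, h2, _root_.one_mul, _root_.mul_one]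
  ext; simp [B.one_mul, Algebra.smul_def]; ring

lemma pull_unitHom_third_sandwich (j : H →ₗ[k] A) :
    pull (CoalgHom.lTensor H (CoalgHom.lTensor H (mergeHead B.unitHom H))) (B.sandwich j) =
      extMul 1 (extMul (toConv j) 1) := by
  have h1 : pull (CoalgHom.lTensor H (CoalgHom.lTensor H (mergeHead B.unitHom H)))
      (pull (dropLeft k H (H ⊗[k] (H ⊗[k] H))) (trilin A B.ω)) = 1 := by
    ext; simp [B.ω_one, mul_comm, mul_left_comm, Algebra.smul_def]
  have h2 : pull (CoalgHom.lTensor H (CoalgHom.lTensor H (mergeHead B.unitHom H)))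
      (pull (CoalgHom.lTensor H (CoalgHom.lTensor H (dropRight k H H))) (trilin A B.ω)) = 1 := by
    ext; simp [B.ω_apply_one, mul_comm, mul_left_comm, Algebra.smul_def]
  simp only [sandwich, map_mul, h1, h2, _root_.one_mul, _root_.mul_one]
  ext; simp [B.mul_one, Algebra.smul_def]; ring

lemma sandwich_mul_eq (j : H →ₗ[k] A) :
    pull (CoalgHom.lTensor H (mergeHead B.mulHom (H ⊗[k] H))) (B.sandwich j) *
        pull (regroup k H (H ⊗[k] H)) (extMul (trilin A B.ω) 1) =
      pull (CoalgHom.lTensor H (CoalgHom.lTensor H (CoalgHom.lTensor H B.mulHom)))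
          (pull (dropLeft k H (H ⊗[k] (H ⊗[k] H))) (trilin A B.ωInv)) *
        (extMul 1 (extMul 1 (trilin A B.ω)) *
          pull (CoalgHom.lTensor H (CoalgHom.lTensor H (mergeHead B.mulHom H))) (B.sandwich j)) *
        pull (mergeHead B.mulHom (H ⊗[k] (H ⊗[k] H)))
          (pull (CoalgHom.lTensor H (CoalgHom.lTensor H (dropRight k H H))) (trilin A B.ω)) := by
  let m := B.mulHom
  let d := dropLeft k H (H ⊗[k] (H ⊗[k] (H ⊗[k] H)))
  let d' := dropLeft k H (H ⊗[k] (H ⊗[k] H))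
  let q := CoalgHom.lTensor H (CoalgHom.lTensor H (CoalgHom.lTensor H (dropRight k H H)))
  let q' := CoalgHom.lTensor H (CoalgHom.lTensor H (dropRight k H H))
  let q'' := CoalgHom.lTensor H (dropRight k H H)
  let s := CoalgHom.lTensor H (mergeHead m (H ⊗[k] H))
  let t := CoalgHom.lTensor H (CoalgHom.lTensor H (mergeHead m H))
  let u := CoalgHom.lTensor H (CoalgHom.lTensor H (CoalgHom.lTensor H m))
  let ω := trilin A B.ω
  have hd : pull u (pull d' ω) * pull s (pull d' ω) =
      extMul 1 (extMul 1 ω) * (pull t (pull d' ω) * pull d (pull q' ω)) := by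
    have h := congrArg (pull d) (B.cocycle_trilin (A := A))
    simp only [map_mul] at h
    convert h using 2
    · ext; simp [u, d, d', m, ω]
    · ext; simp [s, d, d', m, ω]
    · ext; simp [d, ω, Algebra.smul_def]
    · congr 1
      ext; simp [t, d, d', m, ω]
  have hq : pull t (pull q' ω) * pull (mergeHead m (H ⊗[k] (H ⊗[k] H))) (pull q' ω) =
      pull d (pull q' ω) * (pull s (pull q' ω) *
        pull (regroup k H (H ⊗[k] H)) (extMul ω 1)) := by
    have h := congrArg (pull q) (B.cocycle_trilin (A := A))
    simp only [map_mul] at h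
    convert h using 2
    · ext; simp [t, q, q', m, ω]
    · ext; simp [q, q', m, ω]
    · ext; simp [d, q, q', ω, smul_smul, mul_comm]
    · congr 1
      · ext; simp [s, q, q', m, ω]
      · ext; simp [q, ω, Algebra.smul_def]; ring
  have ha : pull t (pull (m.comp (q''.comp d')) (toConv j)) * pull d (pull q' ω) =
      pull d (pull q' ω) * pull s (pull (m.comp (q''.comp d')) (toConv j)) := by
    have h := congrArg (pull d) (congrArg (pull q') (B.pull_mul_trilin_ω j))
    simp only [map_mul] at h
    convert h using 2
    · ext; simp [t, d, q', q'', d', m]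
    · ext; simp [s, d, q', q'', d', m]
  have hinv : pull u (pull d' (trilin A B.ωInv)) * pull u (pull d' ω) = 1 := by
    rw [← map_mul, ← map_mul, trilin_ωInv_mul_trilin_ω, map_one, map_one]
  have hΩ : pull s (pull d' ω) = pull u (pull d' (trilin A B.ωInv)) *
      (extMul 1 (extMul 1 ω) * (pull t (pull d' ω) * pull d (pull q' ω))) := by
    rw [← hd, ← _root_.mul_assoc, hinv, _root_.one_mul]
  simp only [sandwich, map_mul]
  change pull s (pull d' ω) * pull s (pull (m.comp (q''.comp d')) (toConv j)) *
      pull s (pull q' ω) * _ = pull u (pull d' (trilin A B.ωInv)) *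
      (_ * (pull t (pull d' ω) * pull t (pull (m.comp (q''.comp d')) (toConv j)) *
      pull t (pull q' ω))) * pull (mergeHead m (H ⊗[k] (H ⊗[k] H))) (pull q' ω)
  rw [hΩ]
  simp only [_root_.mul_assoc]
  rw [hq, ← _root_.mul_assoc (pull d (pull q' ω)) (pull s _), ← ha]
  simp only [_root_.mul_assoc]
  rfl

/-- Uniqueness of preantipode-like maps along `g`, tested against a linear map to a commutative
algebra. -/
lemma comp_eq_comp_of_conditions (g : C →ₗc[k] H) (f s : C →ₗ[k] H) (j : H →ₗ[k] A)
    (hgf : fork .id B.mulHom.toLinearMap ∘ₗ fork g.toLinearMap f =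
      fork .id B.unitHom.toLinearMap ∘ₗ fork g.toLinearMap f)
    (hfg : fork B.mulHom.toLinearMap .id ∘ₗ fork f g.toLinearMap =
      fork B.unitHom.toLinearMap .id ∘ₗ fork f g.toLinearMap)
    (hgs : fork .id B.mulHom.toLinearMap ∘ₗ fork g.toLinearMap s =
      fork .id B.unitHom.toLinearMap ∘ₗ fork g.toLinearMap s)
    (hsg : fork B.mulHom.toLinearMap .id ∘ₗ fork s g.toLinearMap =
      fork B.unitHom.toLinearMap .id ∘ₗ fork s g.toLinearMap)
    (hf : toConv ((trilin A B.ω).ofConv ∘ₗ fork g.toLinearMap (fork f g.toLinearMap)) = 1)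
    (hs : toConv ((trilin A B.ω).ofConv ∘ₗ fork g.toLinearMap (fork s g.toLinearMap)) = 1) :
    j ∘ₗ f = j ∘ₗ s := by
  let T := fork g.toLinearMap (fork f (fork g.toLinearMap (fork s g.toLinearMap)))
  have hleft : (pull (CoalgHom.lTensor H (mergeHead B.mulHom (H ⊗[k] H))) (B.sandwich j) *
      pull (regroup k H (H ⊗[k] H)) (extMul (trilin A B.ω) 1)).ofConv ∘ₗ T = j ∘ₗ s := by
    rw [pull_mul_comp_congr (q := CoalgHom.lTensor H (mergeHead B.unitHom (H ⊗[k] H)))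
      (by simp only [T, fork_lTensor_id_comp_fork, fork_mergeHead_id_comp_fork, hfg]),
      pull_unitHom_second_sandwich, ← map_mul, extMul_mul_extMul, _root_.one_mul, _root_.mul_one]
    change (extMul (trilin A B.ω) (extMul (toConv j) 1)).ofConv ∘ₗ
      (regroup k H (H ⊗[k] H)).toLinearMap ∘ₗ T = _
    rw [regroup_comp_fork]
    apply toConv_injective
    rw [extMul_comp_fork, hf, extMul_comp_fork, one_ofConv_comp_coalgHom]
    simp
  have hright : (pull (CoalgHom.lTensor H (CoalgHom.lTensor H (CoalgHom.lTensor H B.mulHom)))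
          (pull (dropLeft k H (H ⊗[k] (H ⊗[k] H))) (trilin A B.ωInv)) *
        (extMul 1 (extMul 1 (trilin A B.ω)) *
          pull (CoalgHom.lTensor H (CoalgHom.lTensor H (mergeHead B.mulHom H))) (B.sandwich j)) *
        pull (mergeHead B.mulHom (H ⊗[k] (H ⊗[k] H)))
          (pull (CoalgHom.lTensor H (CoalgHom.lTensor H (dropRight k H H))) (trilin A B.ω))).ofConv
      ∘ₗ T = j ∘ₗ f := by
    have hone : pull (mergeHead B.unitHom (H ⊗[k] (H ⊗[k] H)))
        (pull (CoalgHom.lTensor H (CoalgHom.lTensor H (dropRight k H H))) (trilin A B.ω)) = 1 := by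
      ext; simp [B.ω_one_apply, mul_comm, mul_left_comm, Algebra.smul_def]
    have hone' : pull (CoalgHom.lTensor H (CoalgHom.lTensor H (CoalgHom.lTensor H B.unitHom)))
        (pull (dropLeft k H (H ⊗[k] (H ⊗[k] H))) (trilin A B.ωInv)) = 1 := by
      have h : pull (CoalgHom.lTensor H (CoalgHom.lTensor H (CoalgHom.lTensor H B.unitHom)))
          (pull (dropLeft k H (H ⊗[k] (H ⊗[k] H))) (trilin A B.ω)) = 1 := by
        ext; simp [B.ω_apply_one, mul_comm, mul_left_comm, Algebra.smul_def]
      rw [← _root_.mul_one (pull _ (pull _ (trilin A B.ωInv))), ← h, ← map_mul, ← map_mul,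
        trilin_ωInv_mul_trilin_ω, map_one, map_one, h]
    rw [mul_pull_comp_congr (q := mergeHead B.unitHom (H ⊗[k] (H ⊗[k] H)))
      (by simp only [T, fork_id_mergeHead_comp_fork, hgf]), hone, _root_.mul_one,
      ← _root_.mul_assoc, mul_pull_comp_congr
        (q := CoalgHom.lTensor H (CoalgHom.lTensor H (mergeHead B.unitHom H)))
      (by simp only [T, fork_id_lTensor_comp_fork, fork_id_mergeHead_comp_fork, hgs]),
      pull_unitHom_third_sandwich, _root_.mul_assoc, pull_mul_comp_congr
        (q := CoalgHom.lTensor H (CoalgHom.lTensor H (CoalgHom.lTensor H B.unitHom)))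
      (by simp only [T, fork_lTensor_id_comp_fork, hsg]), hone', _root_.one_mul,
      extMul_mul_extMul, extMul_mul_extMul]
    simp only [_root_.one_mul, _root_.mul_one]
    apply toConv_injective
    rw [extMul_comp_fork, extMul_comp_fork, hs, one_ofConv_comp_coalgHom]
    simp
  rw [← hleft, ← hright, sandwich_mul_eq]

/-- Two linear maps satisfying the preantipode identities along a coalgebra morphism `g` agree. -/
lemma eq_of_conditions (g : C →ₗc[k] H) (f s : C →ₗ[k] H)
    (hgf : fork .id B.mulHom.toLinearMap ∘ₗ fork g.toLinearMap f =
      fork .id B.unitHom.toLinearMap ∘ₗ fork g.toLinearMap f)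
    (hfg : fork B.mulHom.toLinearMap .id ∘ₗ fork f g.toLinearMap =
      fork B.unitHom.toLinearMap .id ∘ₗ fork f g.toLinearMap)
    (hgs : fork .id B.mulHom.toLinearMap ∘ₗ fork g.toLinearMap s =
      fork .id B.unitHom.toLinearMap ∘ₗ fork g.toLinearMap s)
    (hsg : fork B.mulHom.toLinearMap .id ∘ₗ fork s g.toLinearMap =
      fork B.unitHom.toLinearMap .id ∘ₗ fork s g.toLinearMap)
    (hf : toConv ((trilin k B.ω).ofConv ∘ₗ fork g.toLinearMap (fork f g.toLinearMap)) = 1)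
    (hs : toConv ((trilin k B.ω).ofConv ∘ₗ fork g.toLinearMap (fork s g.toLinearMap)) = 1) :
    f = s := by
  let _ : Module kᵐᵒᵖ H := Module.compHom H ((RingHom.id k).fromOpposite mul_comm)
  have _ : IsCentralScalar k H := ⟨fun _ _ => rfl⟩
  have hA (t : C →ₗ[k] H)
      (ht : toConv ((trilin k B.ω).ofConv ∘ₗ fork g.toLinearMap (fork t g.toLinearMap)) = 1) :
      toConv ((trilin (TrivSqZeroExt k H) B.ω).ofConv ∘ₗ
        fork g.toLinearMap (fork t g.toLinearMap)) = 1 := by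
    refine ofConv_injective (LinearMap.ext fun z => ?_)
    have h := congrArg (algebraMap k (TrivSqZeroExt k H))
      (LinearMap.congr_fun (congrArg ofConv ht) z)
    simpa [trilin, LinearMap.convOne_def] using h
  have key := B.comp_eq_comp_of_conditions (A := TrivSqZeroExt k H) g f s
    (TrivSqZeroExt.inrHom k H) hgf hfg hgs hsg (hA f hf) (hA s hs)
  ext z
  exact TrivSqZeroExt.inr_injective (LinearMap.congr_fun key z)

lemma trilin_comp_fork_comp (g : C →ₗc[k] H) (s : H →ₗ[k] H)
    (h : toConv ((trilin k B.ω).ofConv ∘ₗ fork .id (fork s .id)) = 1) :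
    toConv ((trilin k B.ω).ofConv ∘ₗ
      fork g.toLinearMap (fork (s ∘ₗ g.toLinearMap) g.toLinearMap)) = 1 := by
  have hfork : fork g.toLinearMap (fork (s ∘ₗ g.toLinearMap) g.toLinearMap) =
      fork .id (fork s .id) ∘ₗ g.toLinearMap := by
    simp only [fork_comp_coalgHom, LinearMap.id_comp]
  rw [hfork, ← LinearMap.comp_assoc]
  have h' := congrArg ofConv h
  rw [ofConv_toConv] at h'
  rw [h', one_ofConv_comp_coalgHom]

/-- Uniqueness of the preantipode along a coalgebra morphism. -/
lemma eq_comp_of_fork_eq (g : C →ₗc[k] H) (f : C →ₗ[k] H) (s : H →ₗ[k] H)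
    (hgf : fork .id B.mulHom.toLinearMap ∘ₗ fork g.toLinearMap f =
      fork .id B.unitHom.toLinearMap ∘ₗ fork g.toLinearMap f)
    (hfg : fork B.mulHom.toLinearMap .id ∘ₗ fork f g.toLinearMap =
      fork B.unitHom.toLinearMap .id ∘ₗ fork f g.toLinearMap)
    (hf : toConv ((trilin k B.ω).ofConv ∘ₗ fork g.toLinearMap (fork f g.toLinearMap)) = 1)
    (hs : fork .id B.mulHom.toLinearMap ∘ₗ fork .id s =
      fork .id B.unitHom.toLinearMap ∘ₗ fork .id s)
    (hs' : fork B.mulHom.toLinearMap .id ∘ₗ fork s .id =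
      fork B.unitHom.toLinearMap .id ∘ₗ fork s .id)
    (hsω : toConv ((trilin k B.ω).ofConv ∘ₗ fork .id (fork s .id)) = 1) :
    f = s ∘ₗ g.toLinearMap := by
  have hgs : fork g.toLinearMap (s ∘ₗ g.toLinearMap) = fork .id s ∘ₗ g.toLinearMap := by
    rw [fork_comp_coalgHom, LinearMap.id_comp]
  have hsg : fork (s ∘ₗ g.toLinearMap) g.toLinearMap = fork s .id ∘ₗ g.toLinearMap := by
    rw [fork_comp_coalgHom, LinearMap.id_comp]
  refine B.eq_of_conditions g f (s ∘ₗ g.toLinearMap) hgf hfg ?_ ?_ hf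
    (B.trilin_comp_fork_comp g s hsω)
  · rw [hgs, ← LinearMap.comp_assoc, ← LinearMap.comp_assoc, hs]
  · rw [hsg, ← LinearMap.comp_assoc, ← LinearMap.comp_assoc, hs']

/-- The preantipode is determined along `g` by the three defining identities. -/
lemma eq_comp_of_isPreantipode (S : H →ₗ[k] H) (hS : B.IsPreantipode S) (g : C →ₗc[k] H)
    (f : C →ₗ[k] H)
    (hgf : fork .id B.mulHom.toLinearMap ∘ₗ fork g.toLinearMap f =
      fork .id B.unitHom.toLinearMap ∘ₗ fork g.toLinearMap f)
    (hfg : fork B.mulHom.toLinearMap .id ∘ₗ fork f g.toLinearMap =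
      fork B.unitHom.toLinearMap .id ∘ₗ fork f g.toLinearMap)
    (hf : toConv ((trilin k B.ω).ofConv ∘ₗ fork g.toLinearMap (fork f g.toLinearMap)) = 1) :
    f = S ∘ₗ g.toLinearMap :=
  B.eq_comp_of_fork_eq g f S hgf hfg hf
    (B.fork_id_mulHom_comp_fork (CoalgHom.id k H) S hS.2.1)
    (B.fork_mulHom_id_comp_fork (CoalgHom.id k H) S hS.1)
    (B.trilin_comp_fork (CoalgHom.id k H) S hS.2.2)

end Main

end CoquasiBialgebra

/-- Let `C` be a `k`-coalgebra and `H` a `k`-flat coquasi-bialgebra with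
preantipode `S`. If `g, f : C → H` are `k`-linear, `g` is a coalgebra morphism, and
`∑ f(z₂)₁ ⊗ g(z₁)f(z₂)₂ = f(z) ⊗ 1`, `∑ f(z₁)₁g(z₂) ⊗ f(z₁)₂ = 1 ⊗ f(z)`,
`∑ ω(g(z₁) ⊗ f(z₂) ⊗ g(z₃)) = ε(z)` for all `z ∈ C`, then `f = S ∘ g`. -/
theorem preantipode_comp_of_conditions {k H C : Type*} [CommRing k]
    [AddCommGroup H] [Module k H] [Coalgebra k H]
    [AddCommGroup C] [Module k C] [Coalgebra k C]
    [Module.Flat k H]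
    (B : CoquasiBialgebra k H) (S : H →ₗ[k] H) (hS : B.IsPreantipode S)
    (g f : C →ₗ[k] H)
    (hg_comul : Coalgebra.comul (R := k) (A := H) ∘ₗ g =
      TensorProduct.map g g ∘ₗ Coalgebra.comul (R := k) (A := C))
    (hg_counit : Coalgebra.counit (R := k) (A := H) ∘ₗ g = Coalgebra.counit (R := k) (A := C))
    -- `∑ f(z₂)₁ ⊗ g(z₁)f(z₂)₂ = f(z) ⊗ 1`
    (hyp1 : ∀ (z : C) (n : ℕ) (c d : Fin n → C) (m : Fin n → ℕ)
      (e e' : ∀ i, Fin (m i) → H),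
      Coalgebra.comul (R := k) z = ∑ i, c i ⊗ₜ[k] d i →
      (∀ i, Coalgebra.comul (R := k) (f (d i)) = ∑ p, e i p ⊗ₜ[k] e' i p) →
      ∑ i, ∑ p, e i p ⊗ₜ[k] B.mul (g (c i)) (e' i p) = f z ⊗ₜ[k] B.one)
    -- `∑ f(z₁)₁ g(z₂) ⊗ f(z₁)₂ = 1 ⊗ f(z)`
    (hyp2 : ∀ (z : C) (n : ℕ) (c d : Fin n → C) (m : Fin n → ℕ)
      (e e' : ∀ i, Fin (m i) → H),
      Coalgebra.comul (R := k) z = ∑ i, c i ⊗ₜ[k] d i →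
      (∀ i, Coalgebra.comul (R := k) (f (c i)) = ∑ p, e i p ⊗ₜ[k] e' i p) →
      ∑ i, ∑ p, B.mul (e i p) (g (d i)) ⊗ₜ[k] e' i p = B.one ⊗ₜ[k] f z)
    -- `∑ ω(g(z₁) ⊗ f(z₂) ⊗ g(z₃)) = ε(z)`
    (hyp3 : ∀ (z : C) (n : ℕ) (c d : Fin n → C) (m : Fin n → ℕ)
      (d1 d2 : ∀ i, Fin (m i) → C),
      Coalgebra.comul (R := k) z = ∑ i, c i ⊗ₜ[k] d i →
      (∀ i, Coalgebra.comul (R := k) (d i) = ∑ p, d1 i p ⊗ₜ[k] d2 i p) →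
      ∑ i, ∑ p, B.ω (g (c i)) (f (d1 i p)) (g (d2 i p)) =
        Coalgebra.counit (R := k) z) :
    f = S ∘ₗ g := by
  let G : C →ₗc[k] H :=
    { toLinearMap := g, counit_comp := hg_counit, map_comp_comul := hg_comul.symm }
  exact B.eq_comp_of_isPreantipode S hS G f (B.fork_id_mulHom_comp_fork G f hyp1)
    (B.fork_mulHom_id_comp_fork G f hyp2) (B.trilin_comp_fork G f hyp3)
end
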